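/- arXiv:1907.12035 — 2 statements merged into one kernel-verified Lean document; each statement's English description precedes it below -/
import Mathlib

section
/- Let V = Z/nZ with n ≥ 3 be the vertex set of a cycle graph (the dual graph of the minimal resolution of a cusp singularity). For every pair of adjacent vertices v, v' ∈ V (v' = v ± 1) and integers k, k' ≥ 1, taking a ∈ Z_{≥0}^V to be the vector with value k at v, k' at v', and 0 elsewhere, one has Σ_{I ⊆ V} (−1)^{|I|+1} χ(l'_a + E_{J(a,I)}) = 1. (This is the coefficient computation, case (b), proving that the coefficient of t^{kE*_v + k'E*_{v'}} in P(t) = Z(t) of a cusp singularity equals 1 for adjacent v, v'.) -/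
open Finset

/-- The intersection pairing `(x, y) = xᵀ B y` on `ℚ^V` given by an integer matrix `B`. -/
def pairQ {V : Type*} [Fintype V] (B : V → V → ℤ) (x y : V → ℚ) : ℚ :=
  ∑ i, ∑ j, x i * (B i j : ℚ) * y j

/-- The standard basis vector `e_v`. -/
def basisVec {V : Type*} [DecidableEq V] (v : V) : V → ℚ :=
  fun w => if w = v then 1 else 0

/-- `E_J = ∑_{v ∈ J} e_v` for a subset `J ⊆ V`. -/
def EJ {V : Type*} [DecidableEq V] (J : Finset V) : V → ℚ :=
  fun w => if w ∈ J then 1 else 0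

/-- `χ(x) = -(x, x + K)/2`. -/
def chiQ {V : Type*} [Fintype V] (B : V → V → ℤ) (K : V → ℚ) (x : V → ℚ) : ℚ :=
  -(pairQ B x (x + K)) / 2

theorem pairQ_symm' {V : Type*} [Fintype V] (B : V → V → ℤ) (h : ∀ i j, B i j = B j i)
    (x y : V → ℚ) : pairQ B x y = pairQ B y x := by
  unfold pairQ
  rw [Finset.sum_comm]
  refine Finset.sum_congr rfl fun i _ => Finset.sum_congr rfl fun j _ => ?_
  rw [h j i]; ring

theorem pairQ_add_left' {V : Type*} [Fintype V] (B : V → V → ℤ)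
    (x y z : V → ℚ) : pairQ B (x + y) z = pairQ B x z + pairQ B y z := by
  unfold pairQ
  simp only [Pi.add_apply, add_mul, Finset.sum_add_distrib]

theorem pairQ_add_right' {V : Type*} [Fintype V] (B : V → V → ℤ)
    (x y z : V → ℚ) : pairQ B z (x + y) = pairQ B z x + pairQ B z y := by
  unfold pairQ
  simp only [Pi.add_apply, mul_add, Finset.sum_add_distrib]

theorem pairQ_basis_left {V : Type*} [Fintype V] [DecidableEq V] (B : V → V → ℤ)
    (v : V) (y : V → ℚ) : pairQ B (basisVec v) y = ∑ j, (B v j : ℚ) * y j := by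
  unfold pairQ basisVec
  rw [Finset.sum_eq_single v]
  · simp
  · intro b _ hb; simp [hb]
  · simp

theorem pairQ_EJ_left {V : Type*} [Fintype V] [DecidableEq V] (B : V → V → ℤ)
    (S : Finset V) (y : V → ℚ) : pairQ B (EJ S) y = ∑ v ∈ S, pairQ B (basisVec v) y := by
  simp only [pairQ_basis_left]
  unfold pairQ EJ
  rw [← Finset.sum_subset (Finset.subset_univ S)]
  · refine Finset.sum_congr rfl fun i hi => ?_
    simp [hi]
  · intro i _ hi; simp [hi]

theorem cusp_row (n : ℕ) (hn : 3 ≤ n) [NeZero n]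
    (B : ZMod n → ZMod n → ℤ)
    (hBsymm : ∀ i j, B i j = B j i)
    (hBadj : ∀ i, B i (i + 1) = 1)
    (hBoff : ∀ i j, i ≠ j → j ≠ i + 1 → j ≠ i - 1 → B i j = 0)
    (h1 : (1 : ZMod n) ≠ 0) (h2 : (2 : ZMod n) ≠ 0)
    (v : ZMod n) (y : ZMod n → ℚ) :
    pairQ B (basisVec v) y = B v v * y v + y (v + 1) + y (v - 1) := by
  rw [pairQ_basis_left]
  have key : ∀ j, (B v j : ℚ) * y j = (if j = v then B v v * y v else 0)
      + (if j = v + 1 then y (v + 1) else 0) + (if j = v - 1 then y (v - 1) else 0) := by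
    intro j
    by_cases e1 : j = v
    · subst e1
      have a1 : j ≠ j + 1 := by intro h; apply h1; linear_combination -h
      have a2 : j ≠ j - 1 := by intro h; apply h1; linear_combination h
      rw [if_pos rfl, if_neg a1, if_neg a2]; ring
    · by_cases e2 : j = v + 1
      · subst e2
        have a2 : v + 1 ≠ v - 1 := by intro h; apply h2; linear_combination h
        rw [if_neg e1, if_pos rfl, if_neg a2, hBadj]; push_cast; ring
      · by_cases e3 : j = v - 1
        · subst e3
          have := hBadj (v - 1)
          rw [sub_add_cancel] at this
          rw [if_neg e1, if_neg e2, if_pos rfl, hBsymm, this]; push_cast; ring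
        · rw [if_neg e1, if_neg e2, if_neg e3, hBoff v j (Ne.symm e1) e2 e3]; simp
  rw [Finset.sum_congr rfl fun j _ => key j]
  simp [Finset.sum_add_distrib]

theorem cusp_aux (n : ℕ) (hn : 3 ≤ n) [NeZero n]
    (B : ZMod n → ZMod n → ℤ)
    (hBsymm : ∀ i j, B i j = B j i)
    (hBadj : ∀ i, B i (i + 1) = 1)
    (hBoff : ∀ i j, i ≠ j → j ≠ i + 1 → j ≠ i - 1 → B i j = 0)
    (K : ZMod n → ℚ)
    (hK : ∀ v, pairQ B (K + basisVec v) (basisVec v) = -2)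
    (a : ZMod n → ℕ)
    (lpa : ZMod n → ℚ)
    (hlpa : ∀ v, pairQ B lpa (basisVec v) = -(a v : ℚ))
    (J : Finset (ZMod n) → Finset (ZMod n))
    (hJ : ∀ I, I ⊆ J I ∧
      (∀ v ∉ J I, pairQ B (basisVec v) (lpa + EJ (J I)) ≤ 0) ∧
      ∀ J' : Finset (ZMod n), I ⊆ J' →
        (∀ v ∉ J', pairQ B (basisVec v) (lpa + EJ J') ≤ 0) → J I ⊆ J')
    (u : ZMod n) (ha0 : 1 ≤ a u) (ha1 : 1 ≤ a (u + 1))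
    (ha : ∀ w, w ≠ u → w ≠ u + 1 → a w = 0) :
    ∑ I ∈ Finset.univ.powerset,
      (-1 : ℚ) ^ (I.card + 1) * chiQ B K (lpa + EJ (J I)) = 1 := by
  have hc : ∀ m : ℕ, 0 < m → m < n → ((m : ℕ) : ZMod n) ≠ 0 := by
    intro m hm hmn h
    rw [ZMod.natCast_eq_zero_iff] at h
    exact absurd (Nat.le_of_dvd hm h) (by omega)
  have h1 : (1 : ZMod n) ≠ 0 := by simpa using hc 1 (by omega) (by omega)
  have h2 : (2 : ZMod n) ≠ 0 := by simpa using hc 2 (by omega) (by omega)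
  have hcn : ((n : ℕ) : ZMod n) = 0 := ZMod.natCast_self n
  have row := cusp_row n hn B hBsymm hBadj hBoff h1 h2
  have hl : ∀ v, pairQ B (basisVec v) lpa = -(a v : ℚ) := by
    intro v; rw [pairQ_symm' B hBsymm]; exact hlpa v
  have hEJ01 : ∀ (S : Finset (ZMod n)) w, 0 ≤ EJ S w := by
    intro S w; unfold EJ; split_ifs <;> norm_num
  have hcl : ∀ (S : Finset (ZMod n)) v, v ∉ S → pairQ B (basisVec v) (lpa + EJ S) =
      -(a v : ℚ) + EJ S (v + 1) + EJ S (v - 1) := by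
    intro S v hv
    rw [pairQ_add_right', hl, row]
    have : EJ S v = 0 := by simp [EJ, hv]
    rw [this]; ring
  -- propagation
  have prop : ∀ I v, v ≠ u → v ≠ u + 1 → (v + 1 ∈ J I ∨ v - 1 ∈ J I) → v ∈ J I := by
    intro I v hv hv' h
    by_contra hn
    have hle := (hJ I).2.1 v hn
    rw [hcl _ _ hn, ha v hv hv'] at hle
    have p1 := hEJ01 (J I) (v + 1)
    have p2 := hEJ01 (J I) (v - 1)
    rcases h with h | h
    · have : EJ (J I) (v + 1) = 1 := by simp [EJ, h]
      rw [this] at hle; push_cast at hle; linarith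
    · have : EJ (J I) (v - 1) = 1 := by simp [EJ, h]
      rw [this] at hle; push_cast at hle; linarith
  -- the empty set
  have hempty : J ∅ = ∅ := by
    apply Finset.subset_empty.mp
    apply (hJ ∅).2.2 ∅ (Finset.Subset.refl _)
    intro v hv
    rw [hcl _ _ hv]
    have : (0 : ℚ) ≤ a v := by positivity
    simp [EJ]
  have repr : ∀ w : ZMod n, ∃ j : ℕ, j < n ∧ w = u + (j : ZMod n) := by
    intro w
    refine ⟨(w - u).val, ZMod.val_lt _, ?_⟩
    rw [ZMod.natCast_zmod_val]; ring
  have hne0 : ∀ j : ℕ, 0 < j → j < n → u + (j : ZMod n) ≠ u := by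
    intro j hj hjn h; apply hc j hj hjn; linear_combination h
  have hne1 : ∀ j : ℕ, 1 < j → j < n → u + (j : ZMod n) ≠ u + 1 := by
    intro j hj hjn h
    apply hc (j - 1) (by omega) (by omega)
    rw [Nat.cast_sub (by omega)]; push_cast; linear_combination h
  have hlast : u + ((n - 1 : ℕ) : ZMod n) = u - 1 := by
    rw [Nat.cast_sub (by omega), hcn]; push_cast; ring
  have hp0 : u - 1 ≠ u := by rw [← hlast]; exact hne0 _ (by omega) (by omega)
  have hp1 : u - 1 ≠ u + 1 := by rw [← hlast]; exact hne1 _ (by omega) (by omega)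
  have hpmem : ∀ I : Finset (ZMod n), I.Nonempty → u - 1 ∈ J I := by
    rintro I ⟨w, hw⟩
    have hwJ := (hJ I).1 hw
    obtain ⟨j, hj, rfl⟩ := repr w
    rcases Nat.eq_zero_or_pos j with h0 | h0
    · subst h0
      apply prop I _ hp0 hp1
      left; simpa using hwJ
    · have : ∀ i : ℕ, j + i < n → u + ((j + i : ℕ) : ZMod n) ∈ J I := by
        intro i
        induction i with
        | zero => intro _; simpa using hwJ
        | succ i ih =>
          intro hi
          apply prop I _ (hne0 _ (by omega) hi) (hne1 _ (by omega) hi)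
          right
          have := ih (by omega)
          convert this using 1
          push_cast; ring
      have := this (n - 1 - j) (by omega)
      rwa [show j + (n - 1 - j) = n - 1 by omega, hlast] at this
  set P : Finset (ZMod n) := Finset.univ.filter (fun w => w ≠ u ∧ w ≠ u + 1) with hP
  have hPm : ∀ w, w ∈ P ↔ w ≠ u ∧ w ≠ u + 1 := by intro w; simp [hP]
  have hJp : J {u - 1} = P := by
    apply Finset.Subset.antisymm
    · apply (hJ _).2.2
      · rw [Finset.singleton_subset_iff, hPm]; exact ⟨hp0, hp1⟩
      · intro v hv
        rw [hcl _ _ hv]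
        have hv' : v = u ∨ v = u + 1 := by
          rw [hPm] at hv; tauto
        have hb : ∀ w, EJ P w ≤ 1 := by
          intro w; unfold EJ; split_ifs <;> norm_num
        rcases hv' with rfl | rfl
        · have : EJ P (v + 1) = 0 := by simp [EJ, hPm]
          have h3 := hb (v - 1)
          have : (1 : ℚ) ≤ a v := by exact_mod_cast ha0
          linarith
        · have : EJ P (u + 1 - 1) = 0 := by simp [EJ, hPm]
          have h3 := hb (u + 1 + 1)
          have : (1 : ℚ) ≤ a (u + 1) := by exact_mod_cast ha1
          linarith
    · have : ∀ i : ℕ, i + 3 ≤ n → u + ((n - 1 - i : ℕ) : ZMod n) ∈ J {u - 1} := by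
        intro i
        induction i with
        | zero =>
          intro _
          rw [Nat.sub_zero, hlast]
          exact (hJ _).1 (Finset.mem_singleton_self _)
        | succ i ih =>
          intro hi
          apply prop _ _ (hne0 _ (by omega) (by omega)) (hne1 _ (by omega) (by omega))
          left
          have := ih (by omega)
          rw [show n - 1 - i = (n - 1 - (i + 1)) + 1 by omega] at this
          convert this using 1
          push_cast; ring
      intro w hw
      rw [hPm] at hw
      obtain ⟨j, hj, rfl⟩ := repr w
      have j0 : j ≠ 0 := by rintro rfl; simp at hw
      have j1 : j ≠ 1 := by rintro rfl; simp at hw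
      have := this (n - 1 - j) (by omega)
      rwa [show n - 1 - (n - 1 - j) = j by omega] at this
  have hJins : ∀ I : Finset (ZMod n), I.Nonempty → J (insert (u - 1) I) = J I := by
    intro I hI
    apply Finset.Subset.antisymm
    · apply (hJ _).2.2 _ _ (hJ I).2.1
      exact Finset.insert_subset (hpmem I hI) (hJ I).1
    · apply (hJ _).2.2 _ _ (hJ _).2.1
      exact (Finset.subset_insert _ _).trans (hJ _).1
  -- chi computation
  have hE0 : lpa + EJ (∅ : Finset (ZMod n)) = lpa := by
    funext w; simp [EJ]
  have hKr : ∀ v, pairQ B (basisVec v) K = -2 - B v v := by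
    intro v
    have := hK v
    rw [pairQ_add_left', pairQ_symm' B hBsymm K, row v (basisVec v)] at this
    have b1 : v + 1 ≠ v := by intro h; apply h1; linear_combination h
    have b2 : v - 1 ≠ v := by intro h; apply h1; linear_combination -h
    have c0 : (basisVec v : ZMod n → ℚ) v = 1 := by simp [basisVec]
    have c1 : (basisVec v : ZMod n → ℚ) (v + 1) = 0 := by simp only [basisVec, b1, if_false]
    have c2 : (basisVec v : ZMod n → ℚ) (v - 1) = 0 := by simp only [basisVec, b2, if_false]
    rw [c0, c1, c2] at this
    linarith
  have hlE : pairQ B (EJ P) lpa = 0 := by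
    rw [pairQ_EJ_left]
    apply Finset.sum_eq_zero
    intro v hv
    rw [hPm] at hv
    rw [hl, ha v hv.1 hv.2]; simp
  have hu2a : u + 2 ≠ u := by intro h; apply h2; linear_combination h
  have hu2b : u + 2 ≠ u + 1 := by intro h; apply h1; linear_combination h
  have hEE : pairQ B (EJ P) (EJ P + K) = -2 := by
    rw [pairQ_EJ_left]
    have : ∀ v ∈ P, pairQ B (basisVec v) (EJ P + K) =
        -(if v = u + 2 then 1 else 0) - (if v = u - 1 then 1 else 0) := by
      intro v hv
      rw [pairQ_add_right', hKr, row]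
      have e0 : EJ P v = 1 := by simp [EJ, hv]
      have hv' := (hPm v).1 hv
      have e1 : EJ P (v + 1) = 1 - (if v = u - 1 then 1 else 0) := by
        by_cases h : v = u - 1
        · subst h; simp [EJ, hPm]
        · have : v + 1 ∈ P := by
            rw [hPm]
            refine ⟨fun h' => h (by linear_combination h'), fun h' => hv'.1 (by linear_combination h')⟩
          simp [EJ, this, h]
      have e2 : EJ P (v - 1) = 1 - (if v = u + 2 then 1 else 0) := by
        by_cases h : v = u + 2
        · have : v - 1 = u + 1 := by rw [h]; ring
          rw [this]
          simp [EJ, hPm, h]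
        · have : v - 1 ∈ P := by
            rw [hPm]
            refine ⟨fun h' => hv'.2 (by linear_combination h'), fun h' => h (by linear_combination h')⟩
          simp [EJ, this, h]
      rw [e0, e1, e2]; ring
    rw [Finset.sum_congr rfl this, Finset.sum_sub_distrib, Finset.sum_neg_distrib,
      Finset.sum_ite_eq', Finset.sum_ite_eq', if_pos ((hPm _).2 ⟨hu2a, hu2b⟩),
      if_pos ((hPm _).2 ⟨hp0, hp1⟩)]
    norm_num
  have hchi : chiQ B K (lpa + EJ P) - chiQ B K lpa = 1 := by
    unfold chiQ
    have hs := pairQ_symm' B hBsymm lpa (EJ P)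
    simp only [pairQ_add_left', pairQ_add_right'] at hEE ⊢
    rw [hs, hlE]
    linarith
  -- the sum
  have hins : (Finset.univ : Finset (ZMod n)) = insert (u - 1) (Finset.univ.erase (u - 1)) := by
    rw [Finset.insert_erase (Finset.mem_univ _)]
  rw [hins, Finset.sum_powerset_insert (Finset.notMem_erase _ _), ← Finset.sum_add_distrib,
    Finset.sum_eq_single ∅]
  · simp only [insert_empty_eq, Finset.card_singleton, Finset.card_empty, hempty, hJp, hE0]
    linear_combination hchi
  · intro I hI hne
    have hI' : u - 1 ∉ I := fun h => by
      have := Finset.mem_powerset.1 hI h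
      simp at this
    rw [hJins I (Finset.nonempty_iff_ne_empty.2 hne), Finset.card_insert_of_notMem hI']
    ring
  · intro h; simp at h

/-- **Case (b) of the coefficient computation for cusps.**
For a cusp graph (cycle) on `n ≥ 3` vertices and `a = k·δ_v + k'·δ_{v'}` with adjacent
vertices `v, v'` and `k, k' ≥ 1`, `∑_{I ⊆ V} (-1)^{|I|+1} χ(l'_a + E_{J(a,I)}) = 1`. -/
theorem cusp_coeff_case_b (n : ℕ) (hn : 3 ≤ n) [NeZero n]
    (B : ZMod n → ZMod n → ℤ)
    (hBsymm : ∀ i j, B i j = B j i)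
    (hBdiag : ∀ i, B i i ≤ -2)
    (hBadj : ∀ i, B i (i + 1) = 1)
    (hBoff : ∀ i j, i ≠ j → j ≠ i + 1 → j ≠ i - 1 → B i j = 0)
    (hposdef : ∀ x : ZMod n → ℚ, x ≠ 0 → pairQ B x x < 0)
    (K : ZMod n → ℚ)
    (hK : ∀ v, pairQ B (K + basisVec v) (basisVec v) = -2)
    (a : ZMod n → ℕ)
    (lpa : ZMod n → ℚ)
    (hlpa : ∀ v, pairQ B lpa (basisVec v) = -(a v : ℚ))
    (J : Finset (ZMod n) → Finset (ZMod n))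
    (hJ : ∀ I, I ⊆ J I ∧
      (∀ v ∉ J I, pairQ B (basisVec v) (lpa + EJ (J I)) ≤ 0) ∧
      ∀ J' : Finset (ZMod n), I ⊆ J' →
        (∀ v ∉ J', pairQ B (basisVec v) (lpa + EJ J') ≤ 0) → J I ⊆ J')
    (v0 v0' : ZMod n) (hvv' : v0' = v0 + 1 ∨ v0' = v0 - 1)
    (k k' : ℕ) (hk : 1 ≤ k) (hk' : 1 ≤ k')
    (ha : a = fun w => if w = v0 then k else if w = v0' then k' else 0) :
    ∑ I ∈ Finset.univ.powerset,
      (-1 : ℚ) ^ (I.card + 1) * chiQ B K (lpa + EJ (J I)) = 1 := by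
  have hc : ∀ m : ℕ, 0 < m → m < n → ((m : ℕ) : ZMod n) ≠ 0 := by
    intro m hm hmn h
    rw [ZMod.natCast_eq_zero_iff] at h
    exact absurd (Nat.le_of_dvd hm h) (by omega)
  have h1 : (1 : ZMod n) ≠ 0 := by simpa using hc 1 (by omega) (by omega)
  rcases hvv' with h | h
  · have hne : v0 + 1 ≠ v0 := by intro h'; apply h1; linear_combination h'
    subst h
    apply cusp_aux n hn B hBsymm hBadj hBoff K hK a lpa hlpa J hJ v0
    · simp [ha, hk]
    · simp [ha, hk', h1]
    · intro w hw hw'; simp [ha, hw, hw']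
  · have hv : v0 = v0' + 1 := by rw [h]; ring
    have hne : v0' ≠ v0 := by
      intro h'; apply h1; linear_combination -h' - hv
    apply cusp_aux n hn B hBsymm hBadj hBoff K hK a lpa hlpa J hJ v0'
    · simp [ha, hk', hne]
    · rw [← hv]; simp [ha, hk]
    · intro w hw hw'
      rw [← hv] at hw'
      simp [ha, hw, hw']
end

section
/- Let V = Z/nZ with n ≥ 3 be the vertex set of a cycle graph (the dual graph of the minimal resolution of a cusp singularity). Let a ∈ Z_{≥0}^V be nonzero and suppose its support S = {v : a_v > 0} is neither a single vertex nor a pair of adjacent vertices. Then Σ_{I ⊆ V} (−1)^{|I|+1} χ(l'_a + E_{J(a,I)}) = 0. (This is the coefficient computation, case (c), proving that all other coefficients of P(t) = Z(t) of a cusp singularity vanish.) -/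
open Finset

lemma cc_succ_ne (n : ℕ) (hn : 3 ≤ n) (v : ZMod n) : v + 1 ≠ v ∧ v - 1 ≠ v ∧ v + 1 ≠ v - 1 := by
  have h1 : (1 : ZMod n) ≠ 0 := by
    intro h
    have := (ZMod.natCast_eq_zero_iff 1 n).1 (by exact_mod_cast h)
    have := Nat.le_of_dvd (by norm_num) this
    omega
  have h2 : (2 : ZMod n) ≠ 0 := by
    intro h
    have := (ZMod.natCast_eq_zero_iff 2 n).1 (by exact_mod_cast h)
    have := Nat.le_of_dvd (by norm_num) this
    omega
  refine ⟨fun h => h1 ?_, fun h => h1 ?_, fun h => h2 ?_⟩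
  · linear_combination h
  · linear_combination -h
  · linear_combination h

lemma cc_row (n : ℕ) (hn : 3 ≤ n) [NeZero n]
    (B : ZMod n → ZMod n → ℤ)
    (hBsymm : ∀ i j, B i j = B j i)
    (hBadj : ∀ i, B i (i + 1) = 1)
    (hBoff : ∀ i j, i ≠ j → j ≠ i + 1 → j ≠ i - 1 → B i j = 0)
    (y : ZMod n → ℚ) (v : ZMod n) :
    ∑ j, (B v j : ℚ) * y j = B v v * y v + y (v + 1) + y (v - 1) := by
  obtain ⟨h1, h2, h3⟩ := cc_succ_ne n hn v
  have hm : B v (v - 1) = 1 := by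
    rw [hBsymm]; have := hBadj (v - 1); rwa [sub_add_cancel] at this
  rw [← Finset.sum_subset (Finset.subset_univ ({v, v + 1, v - 1} : Finset (ZMod n)))]
  · rw [Finset.sum_insert, Finset.sum_insert, Finset.sum_singleton, hBadj, hm]
    · push_cast; ring
    · simpa using h3
    · simp only [Finset.mem_insert, Finset.mem_singleton, not_or]
      exact ⟨h1.symm, h2.symm⟩
  · intro x _ hx
    simp only [Finset.mem_insert, Finset.mem_singleton, not_or] at hx
    rw [hBoff v x (Ne.symm hx.1) hx.2.1 hx.2.2]; simp

lemma cc_pair (n : ℕ) (hn : 3 ≤ n) [NeZero n]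
    (B : ZMod n → ZMod n → ℤ)
    (hBsymm : ∀ i j, B i j = B j i)
    (hBadj : ∀ i, B i (i + 1) = 1)
    (hBoff : ∀ i j, i ≠ j → j ≠ i + 1 → j ≠ i - 1 → B i j = 0)
    (x y : ZMod n → ℚ) :
    pairQ B x y = ∑ i, x i * (B i i * y i + y (i + 1) + y (i - 1)) := by
  unfold pairQ
  refine Finset.sum_congr rfl fun i _ => ?_
  rw [← cc_row n hn B hBsymm hBadj hBoff, Finset.mul_sum]
  exact Finset.sum_congr rfl fun j _ => by ring

lemma cc_pair_symm {V : Type*} [Fintype V] (B : V → V → ℤ) (hBsymm : ∀ i j, B i j = B j i)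
    (x y : V → ℚ) : pairQ B x y = pairQ B y x := by
  unfold pairQ
  rw [Finset.sum_comm]
  refine Finset.sum_congr rfl fun i _ => Finset.sum_congr rfl fun j _ => ?_
  rw [hBsymm]; ring

lemma cc_pair_add {V : Type*} [Fintype V] (B : V → V → ℤ)
    (x y z : V → ℚ) : pairQ B x (y + z) = pairQ B x y + pairQ B x z := by
  unfold pairQ
  simp only [Pi.add_apply, mul_add, Finset.sum_add_distrib]

lemma cc_pair_basis {V : Type*} [Fintype V] [DecidableEq V] (B : V → V → ℤ)
    (x : V → ℚ) (v : V) : pairQ B (basisVec v) x = ∑ j, (B v j : ℚ) * x j := by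
  unfold pairQ basisVec
  rw [Finset.sum_eq_single v]
  · simp
  · intro b _ hb; simp [hb]
  · simp

lemma cc_pair_sum {V : Type*} [Fintype V] [DecidableEq V] (B : V → V → ℤ)
    (x y : V → ℚ) : pairQ B x y = ∑ v, x v * pairQ B (basisVec v) y := by
  simp only [cc_pair_basis]
  unfold pairQ
  refine Finset.sum_congr rfl fun i _ => ?_
  rw [Finset.mul_sum]
  exact Finset.sum_congr rfl fun j _ => by ring

lemma cc_chi (n : ℕ) (hn : 3 ≤ n) [NeZero n]
    (B : ZMod n → ZMod n → ℤ)
    (hBsymm : ∀ i j, B i j = B j i)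
    (hBadj : ∀ i, B i (i + 1) = 1)
    (hBoff : ∀ i j, i ≠ j → j ≠ i + 1 → j ≠ i - 1 → B i j = 0)
    (K : ZMod n → ℚ)
    (hK : ∀ v, pairQ B (K + basisVec v) (basisVec v) = -2)
    (a : ZMod n → ℕ)
    (lpa : ZMod n → ℚ)
    (hlpa : ∀ v, pairQ B lpa (basisVec v) = -(a v : ℚ)) (J : Finset (ZMod n)) :
    chiQ B K (lpa + EJ J) = chiQ B K lpa +
      ∑ v, ((1 + (a v : ℚ)) * EJ J v - EJ J v * EJ J (v + 1)) := by
  have hE2 : ∀ v, EJ J v * EJ J v = EJ J v := by intro v; unfold EJ; split_ifs <;> simp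
  have e1 : pairQ B (EJ J) lpa = ∑ v, EJ J v * (-(a v : ℚ)) := by
    rw [cc_pair_sum]
    refine Finset.sum_congr rfl fun v _ => ?_
    rw [cc_pair_symm B hBsymm, hlpa]
  have e2 : pairQ B (EJ J) K = ∑ v, EJ J v * (-2 - (B v v : ℚ)) := by
    rw [cc_pair_sum]
    refine Finset.sum_congr rfl fun v _ => ?_
    have h := hK v
    rw [cc_pair_symm B hBsymm, cc_pair_add] at h
    have h3 : pairQ B (basisVec v) (basisVec v) = B v v := by
      rw [cc_pair_basis]; simp [basisVec]
    rw [h3] at h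
    congr 1; linarith
  have e3 : pairQ B (EJ J) (EJ J) = ∑ v, (EJ J v * B v v + 2 * (EJ J v * EJ J (v + 1))) := by
    rw [cc_pair n hn B hBsymm hBadj hBoff]
    have hs : ∑ v, EJ J v * EJ J (v - 1) = ∑ v, EJ J v * EJ J (v + 1) := by
      rw [← Equiv.sum_comp (Equiv.addRight (1 : ZMod n))]
      refine Finset.sum_congr rfl fun v _ => ?_
      simp [mul_comm]
    have : ∀ v, EJ J v * ((B v v : ℚ) * EJ J v + EJ J (v + 1) + EJ J (v - 1)) =
        EJ J v * B v v + EJ J v * EJ J (v + 1) + EJ J v * EJ J (v - 1) := by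
      intro v
      linear_combination (B v v : ℚ) * hE2 v
    simp only [this, Finset.sum_add_distrib, hs, ← Finset.mul_sum]
    ring
  have expand : pairQ B (lpa + EJ J) (lpa + EJ J + K) = pairQ B lpa (lpa + K) +
      2 * pairQ B (EJ J) lpa + pairQ B (EJ J) K + pairQ B (EJ J) (EJ J) := by
    rw [cc_pair_symm B hBsymm]
    simp only [cc_pair_add]
    rw [cc_pair_symm B hBsymm _ lpa, cc_pair_symm B hBsymm _ (EJ J)]
    simp only [cc_pair_add]
    rw [cc_pair_symm B hBsymm lpa (EJ J)]
    ring
  unfold chiQ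
  rw [expand, e1, e2, e3]
  rw [← sub_eq_iff_eq_add']
  have : ∀ X P Q R : ℚ, -(X + 2 * P + Q + R) / 2 - -X / 2 = - P + (-1/2) * Q + (-1/2) * R := by
    intros; ring
  rw [this, Finset.mul_sum, Finset.mul_sum, ← Finset.sum_neg_distrib, ← Finset.sum_add_distrib,
    ← Finset.sum_add_distrib]
  exact Finset.sum_congr rfl fun v _ => by ring

lemma cc_toggle {V : Type*} [Fintype V] [DecidableEq V] (g : Finset V → ℚ) (x : V)
    (h : ∀ I, x ∉ I → g (insert x I) = g I) :
    ∑ I ∈ (Finset.univ : Finset V).powerset, (-1 : ℚ) ^ (I.card + 1) * g I = 0 := by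
  have hx : x ∉ (Finset.univ : Finset V).erase x := by simp
  rw [← Finset.insert_erase (Finset.mem_univ x), Finset.sum_powerset_insert hx,
    ← Finset.sum_add_distrib]
  refine Finset.sum_eq_zero fun I hI => ?_
  have hxI : x ∉ I := fun h' => hx (Finset.mem_powerset.1 hI h')
  rw [h I hxI, Finset.card_insert_of_notMem hxI]
  ring

/-- For a zero vertex, the enclosing zero run together with its ends misses a vertex. -/
lemma cc_run (n : ℕ) (hn : 3 ≤ n) [NeZero n] (a : ZMod n → ℕ)
    (hane : (Finset.univ.filter fun v => 0 < a v).Nonempty)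
    (hnotpt : ¬ ∃ v : ZMod n, (Finset.univ.filter fun v => 0 < a v) = {v})
    (hnotedge : ¬ ∃ v : ZMod n, (Finset.univ.filter fun w => 0 < a w) = {v, v + 1})
    (u : ZMod n) (hu : a u = 0) :
    ∃ (c : ZMod n) (q m : ℕ), 0 < q ∧ q < m ∧ m + 2 ≤ n ∧ u = c + (q : ZMod n) ∧
      0 < a c ∧ 0 < a (c + (m : ZMod n)) ∧ ∀ k : ℕ, 0 < k → k < m → a (c + (k : ZMod n)) = 0 := by
  have hrep : ∀ s : ZMod n, ∃ k : ℕ, k < n ∧ s = u + (k : ZMod n) := fun s =>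
    ⟨(s - u).val, ZMod.val_lt _, by rw [ZMod.natCast_zmod_val]; ring⟩
  have hrep' : ∀ k : ℕ, k ≤ n → u + (k : ZMod n) = u - ((n - k : ℕ) : ZMod n) := by
    intro k hk
    rw [Nat.cast_sub hk]; simp
  obtain ⟨s0, hs0⟩ := hane
  have hs0 : 0 < a s0 := by simpa using hs0
  obtain ⟨k0, hk0, rfl⟩ := hrep s0
  have hk0' : 0 < k0 := by
    rcases Nat.eq_zero_or_pos k0 with rfl | h
    · simp [hu] at hs0
    · exact h
  have exP : ∃ p : ℕ, 0 < p ∧ 0 < a (u + (p : ZMod n)) := ⟨k0, hk0', hs0⟩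
  have exQ : ∃ p : ℕ, 0 < p ∧ 0 < a (u - (p : ZMod n)) :=
    ⟨n - k0, by omega, by rw [← hrep' k0 hk0.le]; exact hs0⟩
  classical
  obtain ⟨p, ⟨hp, hap⟩, hpmin⟩ : ∃ p : ℕ, (0 < p ∧ 0 < a (u + (p : ZMod n))) ∧
      ∀ k < p, ¬ (0 < k ∧ 0 < a (u + (k : ZMod n))) :=
    ⟨Nat.find exP, Nat.find_spec exP, fun k hk => Nat.find_min exP hk⟩
  obtain ⟨q, ⟨hq, haq⟩, hqmin⟩ : ∃ p : ℕ, (0 < p ∧ 0 < a (u - (p : ZMod n))) ∧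
      ∀ k < p, ¬ (0 < k ∧ 0 < a (u - (k : ZMod n))) :=
    ⟨Nat.find exQ, Nat.find_spec exQ, fun k hk => Nat.find_min exQ hk⟩
  have hS : ∀ s, 0 < a s → ∃ k : ℕ, p ≤ k ∧ k + q ≤ n ∧ s = u + (k : ZMod n) := by
    intro s hs
    obtain ⟨k, hk, rfl⟩ := hrep s
    have hk' : 0 < k := by
      rcases Nat.eq_zero_or_pos k with rfl | h
      · simp [hu] at hs
      · exact h
    refine ⟨k, ?_, ?_, rfl⟩
    · by_contra h
      exact hpmin k (by omega) ⟨hk', hs⟩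
    · by_contra h
      exact hqmin (n - k) (by omega) ⟨by omega, by rw [← hrep' k hk.le]; exact hs⟩
  have hpq : p + q + 2 ≤ n := by
    obtain ⟨k1, h1, h2, -⟩ := hS _ hap
    by_contra hcon
    have : p + q = n ∨ p + q + 1 = n := by omega
    rcases this with h | h
    · apply hnotpt
      refine ⟨u + p, ?_⟩
      ext s
      simp only [Finset.mem_filter, Finset.mem_univ, true_and, Finset.mem_singleton]
      constructor
      · intro hs
        obtain ⟨k, h3, h4, rfl⟩ := hS s hs
        have : k = p := by omega
        rw [this]
      · rintro rfl; exact hap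
    · apply hnotedge
      refine ⟨u + p, ?_⟩
      ext s
      simp only [Finset.mem_filter, Finset.mem_univ, true_and, Finset.mem_singleton,
        Finset.mem_insert]
      constructor
      · intro hs
        obtain ⟨k, h3, h4, rfl⟩ := hS s hs
        have : k = p ∨ k = p + 1 := by omega
        rcases this with rfl | rfl
        · left; rfl
        · right; push_cast; ring
      · rintro (rfl | rfl)
        · exact hap
        · have := hrep' (p + 1) (by omega)
          have h5 : n - (p + 1) = q := by omega
          rw [h5] at this
          push_cast at this
          rw [add_assoc, this]; exact haq
  refine ⟨u - q, q, q + p, hq, by omega, by omega, by ring, haq, ?_, ?_⟩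
  · push_cast
    rw [← add_assoc, sub_add_cancel]; exact hap
  · intro k hk hkm
    by_contra hne
    have hpos : 0 < a (u - q + k) := Nat.pos_of_ne_zero hne
    rcases lt_trichotomy k q with h | rfl | h
    · refine hqmin (q - k) (by omega) ⟨by omega, ?_⟩
      rw [Nat.cast_sub h.le]
      convert hpos using 2; ring
    · simp [hu] at hpos
    · refine hpmin (k - q) (by omega) ⟨by omega, ?_⟩
      rw [Nat.cast_sub h.le]
      convert hpos using 2; ring

lemma cc_EJ_nonneg {V : Type*} [DecidableEq V] (J : Finset V) (v : V) : 0 ≤ EJ J v := by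
  unfold EJ; split_ifs <;> norm_num

lemma cc_EJ_le {V : Type*} [DecidableEq V] (J : Finset V) (v : V) : EJ J v ≤ 1 := by
  unfold EJ; split_ifs <;> norm_num

lemma cc_EJ_mono {V : Type*} [DecidableEq V] {J J' : Finset V} (h : J ⊆ J') (v : V) :
    EJ J v ≤ EJ J' v := by
  unfold EJ
  by_cases h1 : v ∈ J
  · simp [h1, h h1]
  · simp only [h1, if_false]; split_ifs <;> norm_num

lemma cc_EJ_mem {V : Type*} [DecidableEq V] {J : Finset V} {v : V} (h : v ∈ J) :
    EJ J v = 1 := by simp [EJ, h]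

lemma cc_EJ_not {V : Type*} [DecidableEq V] {J : Finset V} {v : V} (h : v ∉ J) :
    EJ J v = 0 := by simp [EJ, h]

/-- closed sets, combinatorially -/
def ccClosed {n : ℕ} (a : ZMod n → ℕ) (J : Finset (ZMod n)) : Prop :=
  ∀ v ∉ J, EJ J (v + 1) + EJ J (v - 1) ≤ (a v : ℚ)

lemma cc_zero_right {n : ℕ} {a : ZMod n → ℕ} {J : Finset (ZMod n)} (h : ccClosed a J)
    (v : ZMod n) (hv : a v = 0) : (v + 1 ∈ J → v ∈ J) ∧ (v - 1 ∈ J → v ∈ J) := by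
  constructor <;>
  · intro h1
    by_contra h2
    have := h v h2
    rw [cc_EJ_mem h1, hv] at this
    have h3 := cc_EJ_nonneg J (v - 1)
    have h4 := cc_EJ_nonneg J (v + 1)
    push_cast at this
    linarith

/-- Removing `T` from the hull of `I`. -/
lemma cc_remove {n : ℕ} {a : ZMod n → ℕ} {I J : Finset (ZMod n)} (hI : I ⊆ J)
    (h : ccClosed a J) (hmin : ∀ J', I ⊆ J' → ccClosed a J' → J ⊆ J')
    (T : Finset (ZMod n)) (hTJ : ∃ t ∈ T, t ∈ J) (hTI : ∀ t ∈ T, t ∉ I)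
    (hT : ∀ t ∈ T, EJ (J \ T) (t + 1) + EJ (J \ T) (t - 1) ≤ (a t : ℚ)) : False := by
  obtain ⟨t, ht, htJ⟩ := hTJ
  have := hmin (J \ T) (fun i hi => Finset.mem_sdiff.2 ⟨hI hi, fun h' => hTI i h' hi⟩) ?_ htJ
  · exact (Finset.mem_sdiff.1 this).2 ht
  · intro v hv
    by_cases hvT : v ∈ T
    · exact hT v hvT
    · have hvJ : v ∉ J := fun h' => hv (Finset.mem_sdiff.2 ⟨h', hvT⟩)
      have h1 := h v hvJ
      have h2 := cc_EJ_mono (Finset.sdiff_subset : J \ T ⊆ J) (v + 1)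
      have h3 := cc_EJ_mono (Finset.sdiff_subset : J \ T ⊆ J) (v - 1)
      linarith

lemma cc_edge {n : ℕ} {a : ZMod n → ℕ} {I J : Finset (ZMod n)} (hI : I ⊆ J)
    (h : ccClosed a J) (hmin : ∀ J', I ⊆ J' → ccClosed a J' → J ⊆ J')
    (v : ZMod n) (hv : 0 < a v) (hw : 0 < a (v + 1)) :
    EJ J v * EJ J (v + 1) = (EJ J v - EJ I v) + (EJ J (v + 1) - EJ I (v + 1))
      + EJ I v * EJ I (v + 1) := by
  have hv' : (1 : ℚ) ≤ a v := by exact_mod_cast hv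
  have hw' : (1 : ℚ) ≤ a (v + 1) := by exact_mod_cast hw
  have A : v ∈ J → v ∉ I → v + 1 ∈ J := by
    intro h1 h2
    by_contra h3
    refine cc_remove hI h hmin {v} ⟨v, by simp, h1⟩ (by simpa using h2) ?_
    intro t ht
    obtain rfl := Finset.mem_singleton.1 ht
    have := cc_EJ_not (J := J \ {t}) (v := t + 1) (fun h' => h3 (Finset.mem_sdiff.1 h').1)
    rw [this]
    have := cc_EJ_le (J \ {t}) (t - 1)
    linarith
  have A' : v + 1 ∈ J → v + 1 ∉ I → v ∈ J := by
    intro h1 h2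
    by_contra h3
    refine cc_remove hI h hmin {v + 1} ⟨v + 1, by simp, h1⟩ (by simpa using h2) ?_
    intro t ht
    obtain rfl := Finset.mem_singleton.1 ht
    have := cc_EJ_not (J := J \ {v + 1}) (v := v + 1 - 1)
      (fun h' => h3 (by simpa using (Finset.mem_sdiff.1 h').1))
    rw [this]
    have := cc_EJ_le (J \ {v + 1}) (v + 1 + 1)
    linarith
  have C : v ∈ J → v ∉ I → v + 1 ∈ J → v + 1 ∉ I → False := by
    intro h1 h2 h3 h4
    refine cc_remove hI h hmin {v, v + 1} ⟨v, by simp, h1⟩ ?_ ?_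
    · intro t ht
      simp only [Finset.mem_insert, Finset.mem_singleton] at ht
      rcases ht with rfl | rfl <;> assumption
    · intro t ht
      simp only [Finset.mem_insert, Finset.mem_singleton] at ht
      rcases ht with rfl | rfl
      · have := cc_EJ_not (J := J \ {t, t + 1}) (v := t + 1) (by simp)
        rw [this]
        have := cc_EJ_le (J \ {t, t + 1}) (t - 1)
        linarith
      · have := cc_EJ_not (J := J \ {v, v + 1}) (v := v + 1 - 1) (by simp)
        rw [this]
        have := cc_EJ_le (J \ {v, v + 1}) (v + 1 + 1)
        linarith
  have D : v ∈ I → v ∈ J := fun h' => hI h'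
  have D' : v + 1 ∈ I → v + 1 ∈ J := fun h' => hI h'
  unfold EJ
  by_cases p1 : v ∈ J <;> by_cases p2 : v + 1 ∈ J <;> by_cases p3 : v ∈ I <;>
    by_cases p4 : v + 1 ∈ I <;> simp [p1, p2, p3, p4] <;> tauto

lemma cc_big {n : ℕ} {a : ZMod n → ℕ} {I J : Finset (ZMod n)} (hI : I ⊆ J)
    (h : ccClosed a J) (hmin : ∀ J', I ⊆ J' → ccClosed a J' → J ⊆ J')
    (v : ZMod n) (hv : 2 ≤ a v) : EJ J v = EJ I v := by
  by_cases h1 : v ∈ I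
  · rw [cc_EJ_mem h1, cc_EJ_mem (hI h1)]
  · rw [cc_EJ_not h1]
    apply cc_EJ_not
    intro h2
    refine cc_remove hI h hmin {v} ⟨v, by simp, h2⟩ (by simpa using h1) ?_
    intro t ht
    obtain rfl := Finset.mem_singleton.1 ht
    have hv' : (2 : ℚ) ≤ a t := by exact_mod_cast hv
    have := cc_EJ_le (J \ {t}) (t - 1)
    have := cc_EJ_le (J \ {t}) (t + 1)
    linarith

lemma cc_zero {n : ℕ} {a : ZMod n → ℕ} {I J : Finset (ZMod n)} (hI : I ⊆ J)
    (h : ccClosed a J) (hmin : ∀ J', I ⊆ J' → ccClosed a J' → J ⊆ J')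
    (c : ZMod n) (q m : ℕ) (hq : 0 < q) (hqm : q < m)
    (hc : 0 < a c) (hm : 0 < a (c + (m : ZMod n)))
    (hz : ∀ k : ℕ, 0 < k → k < m → a (c + (k : ZMod n)) = 0) :
    c + (q : ZMod n) ∈ J ↔ ∃ k ≤ m, c + (k : ZMod n) ∈ I := by
  constructor
  · intro hJ
    by_contra hcon
    push Not at hcon
    refine cc_remove hI h hmin ((Finset.range (m + 1)).image fun k : ℕ => c + (k : ZMod n))
      ⟨c + q, Finset.mem_image.2 ⟨q, by simp; omega, rfl⟩, hJ⟩ ?_ ?_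
    · intro t ht
      obtain ⟨k, hk, rfl⟩ := Finset.mem_image.1 ht
      exact hcon k (by simp at hk; omega)
    · intro t ht
      set T := (Finset.range (m + 1)).image fun k : ℕ => c + (k : ZMod n) with hTdef
      have hzero : ∀ k ≤ m, EJ (J \ T) (c + (k : ZMod n)) = 0 := by
        intro k hk
        apply cc_EJ_not
        intro h'
        exact (Finset.mem_sdiff.1 h').2 (Finset.mem_image.2 ⟨k, by simp; omega, rfl⟩)
      obtain ⟨k, hk, rfl⟩ := Finset.mem_image.1 ht
      have hk : k ≤ m := by simp at hk; omega
      have hup : k + 1 ≤ m → EJ (J \ T) (c + (k : ZMod n) + 1) = 0 := by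
        intro h'
        have := hzero (k + 1) h'
        push_cast at this
        rwa [← add_assoc] at this
      have hdown : 0 < k → EJ (J \ T) (c + (k : ZMod n) - 1) = 0 := by
        intro h'
        have := hzero (k - 1) (by omega)
        rw [Nat.cast_sub (by omega)] at this
        push_cast at this
        rwa [← add_sub_assoc] at this
      have l1 := cc_EJ_le (J \ T) (c + (k : ZMod n) + 1)
      have l2 := cc_EJ_le (J \ T) (c + (k : ZMod n) - 1)
      rcases Nat.eq_zero_or_pos k with h0 | h0
      · have : (1 : ℚ) ≤ a (c + (k : ZMod n)) := by
          rw [h0]; simp only [Nat.cast_zero, add_zero]; exact_mod_cast hc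
        rw [hup (by omega)]; linarith
      · rcases Nat.lt_or_ge k m with h1 | h1
        · rw [hup (by omega), hdown h0]; simp
        · have hkm : k = m := by omega
          have : (1 : ℚ) ≤ a (c + (k : ZMod n)) := by
            rw [hkm]; exact_mod_cast hm
          rw [hdown h0]; linarith
  · rintro ⟨k, hk, hkI⟩
    have hkJ := hI hkI
    have up : ∀ d : ℕ, k + d < m → c + ((k + d : ℕ) : ZMod n) ∈ J := by
      intro d
      induction d with
      | zero => intro _; simpa using hkJ
      | succ d ih =>
        intro hd
        refine (cc_zero_right h _ (hz (k + (d + 1)) (by omega) hd)).2 ?_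
        convert ih (by omega) using 1
        push_cast; ring
    have down : ∀ d : ℕ, d < k → c + ((k - d : ℕ) : ZMod n) ∈ J := by
      intro d
      induction d with
      | zero => intro _; simpa using hkJ
      | succ d ih =>
        intro hd
        refine (cc_zero_right h _ (hz (k - (d + 1)) (by omega) (by omega))).1 ?_
        convert ih (by omega) using 1
        rw [Nat.cast_sub (by omega), Nat.cast_sub (by omega)]
        push_cast; ring
    rcases le_total k q with h' | h'
    · have := up (q - k) (by omega)
      rwa [Nat.add_sub_cancel' h'] at this
    · have := down (k - q) (by omega)
      rwa [Nat.sub_sub_self h'] at this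

/-- **Case (c) of the coefficient computation for cusps.**
For a cusp graph (cycle) on `n ≥ 3` vertices and `a ≠ 0` whose support is neither a single
vertex nor a pair of adjacent vertices, `∑_{I ⊆ V} (-1)^{|I|+1} χ(l'_a + E_{J(a,I)}) = 0`. -/
theorem cusp_coeff_case_c (n : ℕ) (hn : 3 ≤ n) [NeZero n]
    (B : ZMod n → ZMod n → ℤ)
    (hBsymm : ∀ i j, B i j = B j i)
    (hBdiag : ∀ i, B i i ≤ -2)
    (hBadj : ∀ i, B i (i + 1) = 1)
    (hBoff : ∀ i j, i ≠ j → j ≠ i + 1 → j ≠ i - 1 → B i j = 0)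
    (hposdef : ∀ x : ZMod n → ℚ, x ≠ 0 → pairQ B x x < 0)
    (K : ZMod n → ℚ)
    (hK : ∀ v, pairQ B (K + basisVec v) (basisVec v) = -2)
    (a : ZMod n → ℕ)
    (lpa : ZMod n → ℚ)
    (hlpa : ∀ v, pairQ B lpa (basisVec v) = -(a v : ℚ))
    (J : Finset (ZMod n) → Finset (ZMod n))
    (hJ : ∀ I, I ⊆ J I ∧
      (∀ v ∉ J I, pairQ B (basisVec v) (lpa + EJ (J I)) ≤ 0) ∧
      ∀ J' : Finset (ZMod n), I ⊆ J' →
        (∀ v ∉ J', pairQ B (basisVec v) (lpa + EJ J') ≤ 0) → J I ⊆ J')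
    (hane : (Finset.univ.filter fun v => 0 < a v).Nonempty)
    (hnotpt : ¬ ∃ v : ZMod n, (Finset.univ.filter fun v => 0 < a v) = {v})
    (hnotedge : ¬ ∃ v : ZMod n, (Finset.univ.filter fun w => 0 < a w) = {v, v + 1}) :
    ∑ I ∈ Finset.univ.powerset,
      (-1 : ℚ) ^ (I.card + 1) * chiQ B K (lpa + EJ (J I)) = 0 := by
  classical
  have hJ' : ∀ I, I ⊆ J I ∧ ccClosed a (J I) ∧
      ∀ J', I ⊆ J' → ccClosed a J' → J I ⊆ J' := by
    have key : ∀ (X : Finset (ZMod n)), ∀ v ∉ X,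
        pairQ B (basisVec v) (lpa + EJ X) = EJ X (v + 1) + EJ X (v - 1) - a v := by
      intro X v hv
      rw [cc_pair_add, cc_pair_symm B hBsymm, hlpa, cc_pair_basis,
        cc_row n hn B hBsymm hBadj hBoff, cc_EJ_not hv]
      ring
    intro I
    obtain ⟨h1, h2, h3⟩ := hJ I
    refine ⟨h1, fun v hv => ?_, fun J' hIJ hcl => h3 J' hIJ fun v hv => ?_⟩
    · have := h2 v hv
      rw [key _ v hv] at this
      linarith
    · rw [key _ v hv]
      have := hcl v hv
      linarith
  clear hJ
  set P := (Finset.univ : Finset (ZMod n)).powerset with hP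
  set N : ZMod n → ℚ := fun v => ∑ I ∈ P, (-1 : ℚ) ^ (I.card + 1) * EJ (J I) v with hN
  set M : ZMod n → ℚ := fun v =>
    ∑ I ∈ P, (-1 : ℚ) ^ (I.card + 1) * (EJ (J I) v * EJ (J I) (v + 1)) with hM
  set σ : ZMod n → ℚ := fun v => if 0 < a v then 1 else 0 with hσ
  have hI0 : ∀ v, ∑ I ∈ P, (-1 : ℚ) ^ (I.card + 1) * EJ I v = 0 := by
    intro v
    refine cc_toggle (fun I => EJ I v) (v + 1) fun I _ => ?_
    have := (cc_succ_ne n hn v).1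
    simp [EJ, this.symm]
  have hI1 : ∀ v, ∑ I ∈ P, (-1 : ℚ) ^ (I.card + 1) * (EJ I v * EJ I (v + 1)) = 0 := by
    intro v
    refine cc_toggle (fun I => EJ I v * EJ I (v + 1)) (v - 1) fun I _ => ?_
    obtain ⟨h1, h2, h3⟩ := cc_succ_ne n hn v
    simp [EJ, h2.symm, h3]
  have hN0 : ∀ v, a v = 0 → N v = 0 := by
    intro v hv
    obtain ⟨c, q, m, hq, hqm, hmn, rfl, hc, hm, hz⟩ :=
      cc_run n hn a hane hnotpt hnotedge v hv
    refine cc_toggle (fun I => EJ (J I) (c + (q : ZMod n))) (c + ((m + 1 : ℕ) : ZMod n))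
      fun I _ => ?_
    have e : ∀ I, c + (q : ZMod n) ∈ J I ↔ ∃ k ≤ m, c + (k : ZMod n) ∈ I := fun I =>
      cc_zero (hJ' I).1 (hJ' I).2.1 (hJ' I).2.2 c q m hq hqm hc hm hz
    have e2 : c + (q : ZMod n) ∈ J (insert (c + ((m + 1 : ℕ) : ZMod n)) I) ↔
        c + (q : ZMod n) ∈ J I := by
      rw [e, e]
      refine exists_congr fun k => and_congr_right fun hk => ?_
      rw [Finset.mem_insert]
      refine or_iff_right fun h => ?_
      have h := add_left_cancel h
      rw [ZMod.natCast_eq_natCast_iff'] at h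
      rw [Nat.mod_eq_of_lt (by omega), Nat.mod_eq_of_lt (by omega)] at h
      omega
    simp only [EJ, e2]
  have hNbig : ∀ v, 2 ≤ a v → N v = 0 := by
    intro v hv
    rw [← hI0 v]
    refine Finset.sum_congr rfl fun I _ => ?_
    rw [cc_big (hJ' I).1 (hJ' I).2.1 (hJ' I).2.2 v hv]
  have hMe : ∀ v, M v = σ v * N v + σ (v + 1) * N (v + 1) := by
    intro v
    have idem : ∀ (X : Finset (ZMod n)) w, EJ X w * EJ X w = EJ X w := by
      intro X w; unfold EJ; split_ifs <;> simp
    rcases Nat.eq_zero_or_pos (a v) with h1 | h1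
    · have : M v = N (v + 1) := by
        refine Finset.sum_congr rfl fun I _ => ?_
        congr 1
        by_cases hm : v + 1 ∈ J I
        · rw [cc_EJ_mem hm, cc_EJ_mem ((cc_zero_right (hJ' I).2.1 v h1).1 hm)]; ring
        · rw [cc_EJ_not hm]; ring
      rw [this, hN0 v h1]
      rcases Nat.eq_zero_or_pos (a (v + 1)) with h2 | h2
      · rw [hN0 _ h2]; ring
      · simp [hσ, h2]
    · rcases Nat.eq_zero_or_pos (a (v + 1)) with h2 | h2
      · have : M v = N v := by
          refine Finset.sum_congr rfl fun I _ => ?_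
          congr 1
          by_cases hm : v ∈ J I
          · rw [cc_EJ_mem hm, cc_EJ_mem ((cc_zero_right (hJ' I).2.1 (v + 1) h2).2
              (by simpa using hm))]; ring
          · rw [cc_EJ_not hm]; ring
        rw [this, hN0 _ h2]
        simp [hσ, h1]
      · have : M v = N v - ∑ I ∈ P, (-1 : ℚ) ^ (I.card + 1) * EJ I v
            + (N (v + 1) - ∑ I ∈ P, (-1 : ℚ) ^ (I.card + 1) * EJ I (v + 1))
            + ∑ I ∈ P, (-1 : ℚ) ^ (I.card + 1) * (EJ I v * EJ I (v + 1)) := by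
          simp only [hM, hN]
          rw [← Finset.sum_sub_distrib, ← Finset.sum_sub_distrib, ← Finset.sum_add_distrib,
            ← Finset.sum_add_distrib]
          refine Finset.sum_congr rfl fun I _ => ?_
          rw [cc_edge (hJ' I).1 (hJ' I).2.1 (hJ' I).2.2 v h1 h2]
          ring
        rw [this, hI0, hI0, hI1]
        simp [hσ, h1, h2]
  have hconst : ∑ I ∈ P, (-1 : ℚ) ^ (I.card + 1) * chiQ B K lpa = 0 :=
    cc_toggle (fun _ => chiQ B K lpa) 0 fun _ _ => rfl
  have hmain : ∑ I ∈ P, (-1 : ℚ) ^ (I.card + 1) * chiQ B K (lpa + EJ (J I)) =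
      ∑ v, ((1 + (a v : ℚ)) * N v - M v) := by
    simp only [cc_chi n hn B hBsymm hBadj hBoff K hK a lpa hlpa, mul_add, Finset.sum_add_distrib]
    rw [hconst, zero_add]
    simp only [Finset.mul_sum, hN, hM]
    rw [Finset.sum_comm]
    refine Finset.sum_congr rfl fun v _ => ?_
    rw [← Finset.sum_sub_distrib]
    exact Finset.sum_congr rfl fun I _ => by ring
  rw [hmain]
  have hshift : ∑ v, σ (v + 1) * N (v + 1) = ∑ v, σ v * N v :=
    Equiv.sum_comp (Equiv.addRight (1 : ZMod n)) fun v => σ v * N v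
  simp only [hMe, Finset.sum_sub_distrib, Finset.sum_add_distrib, hshift]
  rw [← Finset.sum_add_distrib, ← Finset.sum_sub_distrib]
  refine Finset.sum_eq_zero fun v _ => ?_
  rcases Nat.eq_zero_or_pos (a v) with h | h
  · rw [hN0 v h]; ring
  · rcases Nat.lt_or_ge (a v) 2 with h2 | h2
    · have h3 : a v = 1 := by omega
      simp only [hσ, h3]; norm_num
      try ring
    · rw [hNbig v h2]; ring
end
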